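/- Let f : [0,∞) → ℝ be continuous and matrix convex with f(0) ≤ 0, and let h : (0,∞) → (0,∞) be continuous and matrix concave with h > 0 (i.e., h(R) is positive definite for positive definite R). For commuting positive definite n×n matrices L, R define the generalized (Maréchal) perspective (fΔh)(L,R) = f(L·h(R)⁻¹)·h(R) = h(R)^{1/2} f(h(R)^{-1/2} L h(R)^{-1/2}) h(R)^{1/2}. Then fΔh is jointly convex: if L₁ commutes with R₁, L₂ commutes with R₂, all positive definite, 0 ≤ c ≤ 1, L = cL₁ + (1-c)L₂, R = cR₁ + (1-c)R₂, and L commutes with R, then (fΔh)(L,R) ≤ c·(fΔh)(L₁,R₁) + (1-c)·(fΔh)(L₂,R₂) in the Loewner order. -/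

import Mathlib

open Matrix
open scoped ComplexOrder

/-- `f` is matrix convex on `[0,∞)`: for every size `k`, the map `T ↦ f(T)` (continuous
functional calculus) is convex, in the Loewner order, on the self-adjoint `k × k` complex
matrices with spectrum contained in `[0,∞)`. -/
def IsMatrixConvexOnIci (f : ℝ → ℝ) : Prop :=
  ∀ (k : ℕ) (S T : Matrix (Fin k) (Fin k) ℂ), S.IsHermitian → T.IsHermitian →
    spectrum ℝ S ⊆ Set.Ici 0 → spectrum ℝ T ⊆ Set.Ici 0 →
    ∀ c : ℝ, 0 ≤ c → c ≤ 1 →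
      (c • cfc f S + (1 - c) • cfc f T - cfc f (c • S + (1 - c) • T)).PosSemidef

/-- `h` is matrix concave on `(0,∞)`: for every size `k`, the map `T ↦ h(T)` (continuous
functional calculus) is concave, in the Loewner order, on the positive definite `k × k`
complex matrices. -/
def IsMatrixConcaveOnIoi (h : ℝ → ℝ) : Prop :=
  ∀ (k : ℕ) (S T : Matrix (Fin k) (Fin k) ℂ), S.PosDef → T.PosDef →
    ∀ c : ℝ, 0 ≤ c → c ≤ 1 →
      (cfc h (c • S + (1 - c) • T) - (c • cfc h S + (1 - c) • cfc h T)).PosSemidef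

/-- Maréchal's generalized perspective `(fΔh)(L,R) = f(L·h(R)⁻¹)·h(R)` for commuting positive
definite matrices `L` and `R`. -/
noncomputable def marechalPerspective (f h : ℝ → ℝ) {k : ℕ}
    (L R : Matrix (Fin k) (Fin k) ℂ) : Matrix (Fin k) (Fin k) ℂ :=
  cfc f (L * (cfc h R)⁻¹) * cfc h R

namespace Matrix

theorem PosSemidef.real_smul {n : Type*} {A : Matrix n n ℂ} (hA : A.PosSemidef) {c : ℝ}
    (hc : 0 ≤ c) : (c • A).PosSemidef := by
  have h := hA.smul (Complex.zero_le_real.2 hc)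
  rwa [← Complex.coe_smul]

theorem PosDef.convex_combination {n : Type*} {A B : Matrix n n ℂ} (hA : A.PosDef)
    (hB : B.PosDef) {c : ℝ} (hc0 : 0 ≤ c) (hc1 : c ≤ 1) : (c • A + (1 - c) • B).PosDef := by
  rcases hc0.eq_or_lt with rfl | hc
  · simpa using hB
  · have h : (c • A).PosDef := by
      have h := hA.smul (Complex.zero_lt_real.2 hc)
      rwa [← Complex.coe_smul]
    exact h.add_posSemidef (hB.posSemidef.real_smul (sub_nonneg.2 hc1))

variable {m n : Type*} [Fintype m] [DecidableEq m] [Fintype n] [DecidableEq n]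

theorem aeval_mul_eq_mul_aeval_of_intertwine {A : Matrix m m ℂ} {B : Matrix n n ℂ}
    {V : Matrix m n ℂ} (hV : A * V = V * B) (p : Polynomial ℝ) :
    Polynomial.aeval A p * V = V * Polynomial.aeval B p := by
  induction p using Polynomial.induction_on' with
  | add p q hp hq => simp only [map_add, Matrix.add_mul, Matrix.mul_add, hp, hq]
  | monomial d a =>
    have hpow : A ^ d * V = V * B ^ d := by
      induction d with
      | zero => simp
      | succ d ih => rw [pow_succ, pow_succ, Matrix.mul_assoc, hV, ← Matrix.mul_assoc, ih,
          Matrix.mul_assoc]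
    simp only [Polynomial.aeval_monomial, Algebra.algebraMap_eq_smul_one, smul_mul_assoc, one_mul,
      Matrix.smul_mul, Matrix.mul_smul, hpow]

/-- The functional calculus respects intertwining relations between Hermitian matrices. -/
theorem cfc_mul_eq_mul_cfc_of_intertwine (f : ℝ → ℝ) {A : Matrix m m ℂ} {B : Matrix n n ℂ}
    (hA : A.IsHermitian) (hB : B.IsHermitian) {V : Matrix m n ℂ} (hV : A * V = V * B) :
    cfc f A * V = V * cfc f B := by
  let s : Finset ℝ := (A.finite_real_spectrum.union B.finite_real_spectrum).toFinset
  let p : Polynomial ℝ := Lagrange.interpolate s id f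
  have hp : ∀ x ∈ s, f x = p.eval x := fun x hx =>
    (Lagrange.eval_interpolate_at_node f (v := id) (Set.injOn_id _) hx).symm
  have hfA : cfc f A = Polynomial.aeval A p := by
    rw [← cfc_polynomial p A hA.isSelfAdjoint]
    exact cfc_congr fun x hx => hp x (by simp [s, hx])
  have hfB : cfc f B = Polynomial.aeval B p := by
    rw [← cfc_polynomial p B hB.isSelfAdjoint]
    exact cfc_congr fun x hx => hp x (by simp [s, hx])
  rw [hfA, hfB, aeval_mul_eq_mul_aeval_of_intertwine hV]

theorem PosSemidef.spectrum_real_subset_Ici {A : Matrix n n ℂ} (hA : A.PosSemidef) :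
    spectrum ℝ A ⊆ Set.Ici 0 := by
  rw [hA.1.spectrum_real_eq_range_eigenvalues]
  rintro _ ⟨i, rfl⟩
  exact hA.eigenvalues_nonneg i

theorem PosSemidef.exists_sqrt {H : Matrix n n ℂ} (hH : H.PosSemidef) :
    ∃ Q : Matrix n n ℂ, Q.IsHermitian ∧ Q * Q = H ∧
      ∀ X : Matrix n n ℂ, Commute X H → Commute X Q := by
  refine ⟨cfc Real.sqrt H, (cfc_predicate Real.sqrt H : IsSelfAdjoint _), ?_, fun X hX =>
    (cfc_mul_eq_mul_cfc_of_intertwine Real.sqrt hH.1 hH.1 hX.symm.eq).symm⟩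
  rw [← cfc_mul Real.sqrt Real.sqrt H]
  conv_rhs => rw [← cfc_id ℝ H hH.1.isSelfAdjoint]
  exact cfc_congr fun x hx => Real.mul_self_sqrt (hH.spectrum_real_subset_Ici hx)

theorem PosDef.isUnit_det_of_mul_self_eq {H Q : Matrix n n ℂ} (hH : H.PosDef) (hQ : Q * Q = H) :
    IsUnit Q.det := by
  have h := (isUnit_iff_isUnit_det H).1 hH.isUnit
  rw [← hQ, det_mul] at h
  exact isUnit_of_mul_isUnit_left h

theorem exists_three_orthogonal_isometries (k : ℕ) :
    ∃ (d : ℕ) (J : Fin 3 → Matrix (Fin d) (Fin k) ℂ),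
      ∀ i j, (J i)ᴴ * J j = if i = j then 1 else 0 := by
  refine ⟨3 * k, fun i => (1 : Matrix (Fin (3 * k)) (Fin (3 * k)) ℂ).submatrix id
    (fun b => finProdFinEquiv (i, b)), fun i j => ?_⟩
  rw [conjTranspose_submatrix, conjTranspose_one,
    ← submatrix_mul _ _ _ _ _ Function.bijective_id, Matrix.mul_one]
  ext a b
  by_cases hij : i = j <;> simp [Matrix.one_apply, hij]

end Matrix

namespace IsMatrixConvexOnIci

variable {f : ℝ → ℝ}

/-- Jensen's inequality for compressions by an isometry. -/
theorem compression_le (hf : IsMatrixConvexOnIci f) {d k : ℕ} {V : Matrix (Fin d) (Fin k) ℂ}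
    (hV : Vᴴ * V = 1) {X : Matrix (Fin d) (Fin d) ℂ} (hX : X.PosSemidef) :
    (Vᴴ * cfc f X * V - cfc f (Vᴴ * X * V)).PosSemidef := by
  let W : Matrix (Fin d) (Fin d) ℂ := (2 : ℝ) • (V * Vᴴ) - 1
  have hWH : Wᴴ = W := by simp [W]
  have hWV : W * V = V := by
    simp only [W, Matrix.sub_mul, Matrix.smul_mul, Matrix.mul_assoc, hV, Matrix.mul_one,
      Matrix.one_mul]
    module
  have hVW : Vᴴ * W = Vᴴ := by
    have h := congrArg conjTranspose hWV
    rwa [conjTranspose_mul, hWH] at h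
  have hWW : W * W = 1 := by
    have h : W * W = (2 : ℝ) • (W * V * Vᴴ) - W := by
      conv_lhs => rw [show W * W = W * ((2 : ℝ) • (V * Vᴴ) - 1) from rfl]
      simp [Matrix.mul_sub, Matrix.mul_assoc]
    rw [h, hWV]
    simp [W]
  have hWXW : (W * X * W).PosSemidef := by
    simpa [hWH] using hX.mul_mul_conjTranspose_same W
  have hfW : cfc f (W * X * W) = W * cfc f X * W := by
    have h := cfc_mul_eq_mul_cfc_of_intertwine f hWXW.1 hX.1 (V := W)
      (by rw [Matrix.mul_assoc, hWW, Matrix.mul_one])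
    rw [← h, Matrix.mul_assoc (cfc f _), hWW, Matrix.mul_one]
  have hVXV : (Vᴴ * X * V).PosSemidef := hX.conjTranspose_mul_mul_same V
  set Y : Matrix (Fin d) (Fin d) ℂ := (1 / 2 : ℝ) • X + (1 - 1 / 2 : ℝ) • (W * X * W) with hY
  have hYpos : Y.PosSemidef :=
    (hX.real_smul (by norm_num)).add (hWXW.real_smul (by norm_num))
  have hYV : Y * V = V * (Vᴴ * X * V) := by
    have h : W * X * W * V = (2 : ℝ) • (V * (Vᴴ * X * V)) - X * V := by
      rw [Matrix.mul_assoc (W * X), hWV]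
      simp [W, Matrix.sub_mul, Matrix.mul_assoc]
    rw [hY, Matrix.add_mul, Matrix.smul_mul, Matrix.smul_mul, h]
    module
  have hfY := cfc_mul_eq_mul_cfc_of_intertwine f hYpos.1 hVXV.1 hYV
  have hconv := (hf d X (W * X * W) hX.1 hWXW.1 hX.spectrum_real_subset_Ici
    hWXW.spectrum_real_subset_Ici (1 / 2) (by norm_num) (by norm_num)).conjTranspose_mul_mul_same V
  rw [← hY, hfW] at hconv
  convert hconv using 1
  have h₁ : Vᴴ * cfc f Y * V = cfc f (Vᴴ * X * V) := by
    rw [Matrix.mul_assoc, hfY, ← Matrix.mul_assoc, hV, Matrix.one_mul]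
  have h₂ : Vᴴ * (W * cfc f X * W) * V = Vᴴ * cfc f X * V := by
    rw [Matrix.mul_assoc, Matrix.mul_assoc (W * cfc f X), hWV, Matrix.mul_assoc W,
      ← Matrix.mul_assoc Vᴴ, hVW, Matrix.mul_assoc]
  simp only [Matrix.mul_sub, Matrix.sub_mul, Matrix.mul_add, Matrix.add_mul, Matrix.mul_smul,
    Matrix.smul_mul, h₁, h₂]
  module

/-- The Hansen–Pedersen–Jensen inequality for a pair of coefficients with
`AᴴA + BᴴB ≤ 1`. -/
theorem jensen (hf : IsMatrixConvexOnIci f) (hf0 : f 0 ≤ 0) {k : ℕ}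
    {S T A B : Matrix (Fin k) (Fin k) ℂ} (hS : S.PosSemidef) (hT : T.PosSemidef)
    (hAB : (1 - (Aᴴ * A + Bᴴ * B)).PosSemidef) :
    (Aᴴ * cfc f S * A + Bᴴ * cfc f T * B - cfc f (Aᴴ * S * A + Bᴴ * T * B)).PosSemidef := by
  obtain ⟨C, hCH, hC, -⟩ := hAB.exists_sqrt
  nth_rw 1 [← hCH.eq] at hC
  obtain ⟨d, J, hJ⟩ := exists_three_orthogonal_isometries k
  have hJ' : ∀ (i j) (M : Matrix (Fin k) (Fin k) ℂ),
      (J i)ᴴ * (J j * M) = if i = j then M else 0 := fun i j M => by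
    rw [← Matrix.mul_assoc, hJ]; split_ifs <;> simp
  let V : Matrix (Fin d) (Fin k) ℂ := J 0 * A + J 1 * B + J 2 * C
  let X : Matrix (Fin d) (Fin d) ℂ := J 0 * S * (J 0)ᴴ + J 1 * T * (J 1)ᴴ
  have hX : X.PosSemidef :=
    (hS.mul_mul_conjTranspose_same (J 0)).add (hT.mul_mul_conjTranspose_same (J 1))
  have hXJ₀ : X * J 0 = J 0 * S := by simp [X, Matrix.add_mul, Matrix.mul_assoc, hJ]
  have hXJ₁ : X * J 1 = J 1 * T := by simp [X, Matrix.add_mul, Matrix.mul_assoc, hJ]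
  have hXJ₂ : X * J 2 = J 2 * (0 : Matrix (Fin k) (Fin k) ℂ) := by
    simp [X, Matrix.add_mul, Matrix.mul_assoc, hJ]
  have hf₀ := cfc_mul_eq_mul_cfc_of_intertwine f hX.1 hS.1 hXJ₀
  have hf₁ := cfc_mul_eq_mul_cfc_of_intertwine f hX.1 hT.1 hXJ₁
  have hf₂ := cfc_mul_eq_mul_cfc_of_intertwine f hX.1 isHermitian_zero hXJ₂
  rw [cfc_apply_zero, Algebra.algebraMap_eq_smul_one] at hf₂
  have hV : Vᴴ * V = 1 := by
    have h : Vᴴ * V = Aᴴ * A + Bᴴ * B + Cᴴ * C := by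
      simp [V, Matrix.add_mul, Matrix.mul_add, Matrix.mul_assoc, hJ']
    rw [h, hC]; abel
  have hVXV : Vᴴ * X * V = Aᴴ * S * A + Bᴴ * T * B := by
    have h : X * V = J 0 * (S * A) + J 1 * (T * B) := by
      simp only [V, Matrix.mul_add, ← Matrix.mul_assoc, hXJ₀, hXJ₁, hXJ₂]
      simp
    rw [Matrix.mul_assoc, h]
    simp [V, Matrix.add_mul, Matrix.mul_add, Matrix.mul_assoc, hJ']
  have hVfV : Vᴴ * cfc f X * V = Aᴴ * cfc f S * A + Bᴴ * cfc f T * B + f 0 • (Cᴴ * C) := by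
    have h : cfc f X * V = J 0 * (cfc f S * A) + J 1 * (cfc f T * B) + f 0 • (J 2 * C) := by
      simp only [V, Matrix.mul_add, ← Matrix.mul_assoc, hf₀, hf₁, hf₂]
      simp
    rw [Matrix.mul_assoc, h]
    simp [V, Matrix.add_mul, Matrix.mul_add, Matrix.mul_assoc, hJ']
  have hmain := hf.compression_le hV hX
  rw [hVXV, hVfV] at hmain
  convert hmain.add ((posSemidef_conjTranspose_mul_self C).real_smul (neg_nonneg.2 hf0)) using 1
  module

end IsMatrixConvexOnIci

/-- Conjugating the perspective into symmetric form: if `Q` is a Hermitian square root of `h(R)`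
commuting with `L`, then `(fΔh)(L,R) = Q f(Q⁻¹ L Q⁻¹) Q`. -/
theorem marechalPerspective_eq_conj (f h : ℝ → ℝ) {k : ℕ} {L R Q : Matrix (Fin k) (Fin k) ℂ}
    (hL : L.IsHermitian) (hQ : Q.IsHermitian) (hQQ : Q * Q = cfc h R) (hdet : IsUnit Q.det)
    (hLQ : Commute L Q) :
    marechalPerspective f h L R = Q * cfc f (Q⁻¹ * L * Q⁻¹) * Q := by
  have hinv : L * Q⁻¹ = Q⁻¹ * L :=
    calc L * Q⁻¹ = Q⁻¹ * (Q * L) * Q⁻¹ := by rw [nonsing_inv_mul_cancel_left _ _ hdet]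
      _ = Q⁻¹ * L := by rw [← hLQ.eq, Matrix.mul_assoc, mul_nonsing_inv_cancel_right _ _ hdet]
  have hT : L * (cfc h R)⁻¹ = Q⁻¹ * L * Q⁻¹ := by
    rw [← hQQ, Matrix.mul_inv_rev, ← Matrix.mul_assoc, hinv]
  have hTH : (Q⁻¹ * L * Q⁻¹).IsHermitian := by
    simpa [hQ.inv.eq] using isHermitian_conjTranspose_mul_mul Q⁻¹ hL
  have hTQ : Q⁻¹ * L * Q⁻¹ * Q = Q * (Q⁻¹ * L * Q⁻¹) := by
    rw [nonsing_inv_mul_cancel_right _ _ hdet, Matrix.mul_assoc,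
      mul_nonsing_inv_cancel_left _ _ hdet, hinv]
  rw [marechalPerspective, hT, ← hQQ, ← Matrix.mul_assoc,
    cfc_mul_eq_mul_cfc_of_intertwine f hTH hTH hTQ]

/-- If `f : [0,∞) → ℝ` is continuous and matrix convex with `f 0 ≤ 0`, and `h : (0,∞) → (0,∞)`
is continuous, matrix concave and matrix-positive, then Maréchal's perspective `fΔh` is jointly
convex on commuting pairs of positive definite matrices, in the Loewner order. -/
theorem marechalPerspective_jointly_convex (f h : ℝ → ℝ)
    (hf : ContinuousOn f (Set.Ici 0)) (hfconv : IsMatrixConvexOnIci f) (hf0 : f 0 ≤ 0)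
    (hh : ContinuousOn h (Set.Ioi 0)) (hhconc : IsMatrixConcaveOnIoi h)
    (hhpos : ∀ (k : ℕ) (R : Matrix (Fin k) (Fin k) ℂ), R.PosDef → (cfc h R).PosDef)
    {k : ℕ} (L₁ R₁ L₂ R₂ L R : Matrix (Fin k) (Fin k) ℂ)
    (hL₁ : L₁.PosDef) (hR₁ : R₁.PosDef) (hL₂ : L₂.PosDef) (hR₂ : R₂.PosDef)
    (hc₁ : Commute L₁ R₁) (hc₂ : Commute L₂ R₂)
    (c : ℝ) (hc0 : 0 ≤ c) (hc1 : c ≤ 1)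
    (hL : L = c • L₁ + (1 - c) • L₂) (hR : R = c • R₁ + (1 - c) • R₂)
    (hcLR : Commute L R) :
    (c • marechalPerspective f h L₁ R₁ + (1 - c) • marechalPerspective f h L₂ R₂
      - marechalPerspective f h L R).PosSemidef := by
  have hRpos : R.PosDef := hR ▸ hR₁.convex_combination hR₂ hc0 hc1
  have hLpos : L.PosDef := hL ▸ hL₁.convex_combination hL₂ hc0 hc1
  have comm_cfc : ∀ {L R : Matrix (Fin k) (Fin k) ℂ}, R.PosDef → Commute L R →
      Commute L (cfc h R) := fun hR hLR =>
    (cfc_mul_eq_mul_cfc_of_intertwine h hR.1 hR.1 hLR.symm.eq).symm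
  obtain ⟨Q₁, hQ₁, hQQ₁, hcomm₁⟩ := (hhpos k R₁ hR₁).posSemidef.exists_sqrt
  have hdet₁ := (hhpos k R₁ hR₁).isUnit_det_of_mul_self_eq hQQ₁
  obtain ⟨Q₂, hQ₂, hQQ₂, hcomm₂⟩ := (hhpos k R₂ hR₂).posSemidef.exists_sqrt
  have hdet₂ := (hhpos k R₂ hR₂).isUnit_det_of_mul_self_eq hQQ₂
  obtain ⟨Q, hQ, hQQ, hcomm⟩ := (hhpos k R hRpos).posSemidef.exists_sqrt
  have hdet := (hhpos k R hRpos).isUnit_det_of_mul_self_eq hQQ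
  rw [marechalPerspective_eq_conj f h hL₁.1 hQ₁ hQQ₁ hdet₁ (hcomm₁ _ (comm_cfc hR₁ hc₁)),
    marechalPerspective_eq_conj f h hL₂.1 hQ₂ hQQ₂ hdet₂ (hcomm₂ _ (comm_cfc hR₂ hc₂)),
    marechalPerspective_eq_conj f h hLpos.1 hQ hQQ hdet (hcomm _ (comm_cfc hRpos hcLR))]
  have hc1' : 0 ≤ 1 - c := sub_nonneg.2 hc1
  let A : Matrix (Fin k) (Fin k) ℂ := √c • (Q₁ * Q⁻¹)
  let B : Matrix (Fin k) (Fin k) ℂ := √(1 - c) • (Q₂ * Q⁻¹)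
  have hA : ∀ M, Aᴴ * M * A = Q⁻¹ * (c • (Q₁ * M * Q₁)) * Q⁻¹ := fun M => by
    simp only [A, conjTranspose_smul, conjTranspose_mul, hQ.inv.eq, hQ₁.eq, Matrix.smul_mul,
      Matrix.mul_smul, smul_smul, star_trivial, Real.mul_self_sqrt hc0, Matrix.mul_assoc]
  have hB : ∀ M, Bᴴ * M * B = Q⁻¹ * ((1 - c) • (Q₂ * M * Q₂)) * Q⁻¹ := fun M => by
    simp only [B, conjTranspose_smul, conjTranspose_mul, hQ.inv.eq, hQ₂.eq, Matrix.smul_mul,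
      Matrix.mul_smul, smul_smul, star_trivial, Real.mul_self_sqrt hc1', Matrix.mul_assoc]
  have conj_inv : ∀ {P : Matrix (Fin k) (Fin k) ℂ}, IsUnit P.det → ∀ M,
      P * (P⁻¹ * M * P⁻¹) * P = M := fun hP M => by
    rw [Matrix.mul_assoc, nonsing_inv_mul_cancel_right _ _ hP, mul_nonsing_inv_cancel_left _ _ hP]
  have inv_pos : ∀ {P M : Matrix (Fin k) (Fin k) ℂ}, P.IsHermitian → M.PosDef →
      (P⁻¹ * M * P⁻¹).PosSemidef := fun {P M} hP hM => by
    simpa [hP.inv.eq] using hM.posSemidef.conjTranspose_mul_mul_same P⁻¹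
  have hAB : (1 - (Aᴴ * A + Bᴴ * B)).PosSemidef := by
    have hconc := (hhconc k R₁ R₂ hR₁ hR₂ c hc0 hc1).conjTranspose_mul_mul_same Q⁻¹
    have h₁ := hA 1
    have h₂ := hB 1
    rw [Matrix.mul_one, Matrix.mul_one, hQQ₁] at h₁
    rw [Matrix.mul_one, Matrix.mul_one, hQQ₂] at h₂
    have h₀ : Q⁻¹ * cfc h R * Q⁻¹ = 1 := by
      rw [← hQQ, nonsing_inv_mul_cancel_left _ _ hdet, mul_nonsing_inv _ hdet]
    rw [← hR, hQ.inv.eq, Matrix.mul_sub, Matrix.sub_mul, h₀, Matrix.mul_add, Matrix.add_mul,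
      ← h₁, ← h₂] at hconc
    exact hconc
  have hJ := (hfconv.jensen hf0 (inv_pos hQ₁ hL₁) (inv_pos hQ₂ hL₂)
    hAB).conjTranspose_mul_mul_same Q
  rw [hA, hB, hA, hB, conj_inv hdet₁, conj_inv hdet₂, ← Matrix.add_mul, ← Matrix.mul_add,
    ← Matrix.add_mul, ← Matrix.mul_add, ← hL, hQ.eq, Matrix.mul_sub, Matrix.sub_mul,
    conj_inv hdet] at hJ
  exact hJ
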